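/- Let K be a nonempty compact metric space and let T = (T(t))_{t ≥ 0} be a strongly continuous contraction semigroup on C(K): each T(t) is a bounded linear operator on C(K), T(0) = I, T(t+s) = T(t)T(s) for all s, t ≥ 0, ‖T(t)u‖_∞ ≤ ‖u‖_∞ for all t ≥ 0 and u ∈ C(K), and t ↦ T(t)u is continuous for each u ∈ C(K). Let H : C(K) → C(K) be continuous and suppose there exist a > 0 and an integer N ≥ 0 such that ⟨H(u + v), φ⟩ ≤ a(1 + ‖v‖_∞)^{2N+1} for all u, v ∈ C(K) and all φ ∈ ∂‖u‖_∞. Let τ > 0, u_0 ∈ C(K), and let u, v : [0, τ) → C(K) be continuous functions such that u(t) = T(t)u_0 + ∫_0^t T(t−s) H(u(s) + v(s)) ds (Bochner integral in C(K)) for all t ∈ [0, τ). Then ‖u(t)‖_∞ ≤ ‖u_0‖_∞ + ∫_0^t a(1 + ‖v(s)‖_∞)^{2N+1} ds for all t ∈ [0, τ). -/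

import Mathlib

open MeasureTheory intervalIntegral

theorem mild_aux {X : Type*} [NormedAddCommGroup X] [NormedSpace ℝ X] [CompleteSpace X]
    [Nontrivial X] (S : ℝ → X →L[ℝ] X)
    (hS0 : S 0 = ContinuousLinearMap.id ℝ X)
    (hSs : ∀ s t : ℝ, 0 ≤ s → 0 ≤ t → S (t + s) = (S t).comp (S s))
    (hSc : ∀ t : ℝ, 0 ≤ t → ∀ w : X, ‖S t w‖ ≤ ‖w‖)
    (hSj : Continuous (fun p : ℝ × X => S p.1 p.2))
    (f u : ℝ → X) (g : ℝ → ℝ) (hf : Continuous f) (hu : Continuous u) (hg : Continuous g)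
    (u₀ : X) (t₁ : ℝ) (ht₁ : 0 ≤ t₁)
    (hd : ∀ t ∈ Set.Icc (0 : ℝ) t₁, ∀ φ : X →L[ℝ] ℝ, ‖φ‖ = 1 → φ (u t) = ‖u t‖ →
      φ (f t) ≤ g t)
    (heq : ∀ t ∈ Set.Icc (0 : ℝ) t₁, u t = S t u₀ + ∫ s in (0 : ℝ)..t, S (t - s) (f s)) :
    ‖u t₁‖ ≤ ‖u₀‖ + ∫ s in (0 : ℝ)..t₁, g s := by
  have hcont : ∀ t : ℝ, Continuous (fun s => S (t - s) (f s)) := fun t =>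
    hSj.comp ((continuous_const.sub continuous_id).prodMk hf)
  have step : ∀ t ∈ Set.Icc (0 : ℝ) t₁, ∀ r, 0 ≤ r → r ≤ t →
      u t = S (t - r) (u r) + ∫ s in r..t, S (t - s) (f s) := by
    intro t ht r hr hrt
    have h1 := heq t ht
    have h2 := heq r ⟨hr, hrt.trans ht.2⟩
    have h3 : S (t - r) (∫ s in (0 : ℝ)..r, S (r - s) (f s))
        = ∫ s in (0 : ℝ)..r, S (t - s) (f s) := by
      rw [← ContinuousLinearMap.intervalIntegral_comp_comm _ ((hcont r).intervalIntegrable _ _)]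
      apply intervalIntegral.integral_congr
      intro s hs
      rw [Set.uIcc_of_le hr] at hs
      have := hSs (r - s) (t - r) (by linarith [hs.2]) (by linarith)
      rw [show t - r + (r - s) = t - s by ring] at this
      simp [this]
    have h4 : S t u₀ = S (t - r) (S r u₀) := by
      have := hSs r (t - r) hr (by linarith)
      rw [show t - r + r = t by ring] at this
      simp [this]
    rw [h2, map_add, h3, add_assoc, intervalIntegral.integral_add_adjacent_intervals
      ((hcont t).intervalIntegrable _ _) ((hcont t).intervalIntegrable _ _), ← h4]
    exact h1
  have hgt : Continuous (fun y => g (t₁ - y)) := hg.comp (continuous_const.sub continuous_id)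
  have hB : ∀ x, HasDerivAt (fun x => -‖u t₁‖ + ∫ y in (0 : ℝ)..x, g (t₁ - y)) (g (t₁ - x)) x :=
    fun x => (hgt.integral_hasStrictDerivAt 0 x).hasDerivAt.const_add _
  have key := image_le_of_liminf_slope_right_le_deriv_boundary
    (f := fun x => -‖u (t₁ - x)‖) (a := 0) (b := t₁)
    (B := fun x => -‖u t₁‖ + ∫ y in (0 : ℝ)..x, g (t₁ - y)) (B' := fun x => g (t₁ - x))
    ((hu.comp (continuous_const.sub continuous_id)).norm.neg.continuousOn) (by simp)
    (fun x _ => (hB x).continuousAt.continuousWithinAt)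
    (fun x _ => (hB x).hasDerivWithinAt) (by
      intro x hx r hr
      apply Filter.Eventually.frequently
      obtain ⟨φ, hφ, hφu⟩ := exists_dual_vector' ℝ (u (t₁ - x))
      have ht : t₁ - x ∈ Set.Icc (0 : ℝ) t₁ := ⟨by linarith [hx.2], by linarith [hx.1]⟩
      have hφu' : φ (u (t₁ - x)) = ‖u (t₁ - x)‖ := by simpa using hφu
      have hk := hd _ ht φ hφ hφu'
      obtain ⟨r', hr1, hr2⟩ := exists_between hr
      have hkc : Continuous (fun s => φ (S (t₁ - x - s) (f s))) := φ.continuous.comp (hcont _)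
      have hlt : φ (S (t₁ - x - (t₁ - x)) (f (t₁ - x))) < r' := by
        rw [sub_self, hS0]
        exact lt_of_le_of_lt hk hr1
      obtain ⟨δ, hδ, hball⟩ := Metric.eventually_nhds_iff.1
        (hkc.continuousAt.eventually_lt continuousAt_const hlt)
      have hmin : x < min (x + δ) t₁ := lt_min (by linarith) hx.2
      filter_upwards [Ioo_mem_nhdsGT hmin] with z hz
      have hz1 : z < x + δ := hz.2.trans_le (min_le_left _ _)
      have hz2 : z < t₁ := hz.2.trans_le (min_le_right _ _)
      have hxz := hz.1
      have hst := step _ ht (t₁ - z) (by linarith) (by linarith)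
      have hle : ‖u (t₁ - x)‖ ≤ ‖u (t₁ - z)‖ + r' * (z - x) := by
        rw [← hφu', hst, map_add, ← ContinuousLinearMap.intervalIntegral_comp_comm _
          ((hcont _).intervalIntegrable _ _)]
        apply add_le_add
        · calc φ (S (t₁ - x - (t₁ - z)) (u (t₁ - z)))
              ≤ ‖φ (S (t₁ - x - (t₁ - z)) (u (t₁ - z)))‖ := le_abs_self _
            _ ≤ ‖φ‖ * ‖S (t₁ - x - (t₁ - z)) (u (t₁ - z))‖ := φ.le_opNorm _
            _ ≤ ‖u (t₁ - z)‖ := by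
              rw [hφ, one_mul]
              exact hSc _ (by linarith) _
        · calc ∫ s in (t₁ - z)..(t₁ - x), φ (S (t₁ - x - s) (f s))
              ≤ ∫ s in (t₁ - z)..(t₁ - x), r' := by
                apply intervalIntegral.integral_mono_on (by linarith)
                  (hkc.intervalIntegrable _ _) (by simp)
                intro s hs
                refine (hball ?_).le
                rw [Real.dist_eq, abs_lt]
                constructor <;> linarith [hs.1, hs.2]
            _ = r' * (z - x) := by simp; ring
      have hpos : 0 < z - x := by linarith
      rw [slope_def_field, div_lt_iff₀ hpos]
      nlinarith)
  have := key (Set.right_mem_Icc.2 ht₁)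
  have hu0 : u 0 = u₀ := by
    have := heq 0 ⟨le_rfl, ht₁⟩
    simpa [hS0] using this
  simp [hu0] at this
  linarith

/-- **A priori bound for mild solutions (Lemma `l.est1`).**
Let `K` be a nonempty compact metric space, `(T(t))_{t≥0}` a strongly continuous
contraction semigroup on `C(K)`, and `H : C(K) → C(K)` continuous with
`⟨H(u+v), φ⟩ ≤ a(1+‖v‖)^{2N+1}` for all `u, v` and all norming functionals
`φ ∈ ∂‖u‖_∞`.  If `u(t) = T(t)u₀ + ∫_0^t T(t-s) H(u(s)+v(s)) ds` on `[0, τ)`, then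
`‖u(t)‖ ≤ ‖u₀‖ + ∫_0^t a(1+‖v(s)‖)^{2N+1} ds` on `[0, τ)`. -/
theorem mild_solution_norm_bound {K : Type*} [MetricSpace K] [CompactSpace K] [Nonempty K]
    (T : ℝ → C(K, ℝ) →L[ℝ] C(K, ℝ))
    (hT0 : T 0 = ContinuousLinearMap.id ℝ C(K, ℝ))
    (hTsemigroup : ∀ s t : ℝ, 0 ≤ s → 0 ≤ t → T (t + s) = (T t).comp (T s))
    (hTcontr : ∀ t : ℝ, 0 ≤ t → ∀ w : C(K, ℝ), ‖T t w‖ ≤ ‖w‖)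
    (hTcont : ∀ w : C(K, ℝ), ContinuousOn (fun t => T t w) (Set.Ici 0))
    (H : C(K, ℝ) → C(K, ℝ)) (hHcont : Continuous H)
    (a : ℝ) (ha : 0 < a) (N : ℕ)
    (hdiss : ∀ (u v : C(K, ℝ)) (φ : C(K, ℝ) →L[ℝ] ℝ), ‖φ‖ = 1 → φ u = ‖u‖ →
      φ (H (u + v)) ≤ a * (1 + ‖v‖) ^ (2 * N + 1))
    (τ : ℝ) (hτ : 0 < τ) (u₀ : C(K, ℝ)) (u v : ℝ → C(K, ℝ))
    (hu : ContinuousOn u (Set.Ico 0 τ)) (hv : ContinuousOn v (Set.Ico 0 τ))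
    (heq : ∀ t ∈ Set.Ico (0 : ℝ) τ,
      u t = T t u₀ + ∫ s in (0 : ℝ)..t, T (t - s) (H (u s + v s))) :
    ∀ t ∈ Set.Ico (0 : ℝ) τ,
      ‖u t‖ ≤ ‖u₀‖ + ∫ s in (0 : ℝ)..t, a * (1 + ‖v s‖) ^ (2 * N + 1) := by
  intro t₁ ht₁
  set c : ℝ → ℝ := fun s => max 0 (min s t₁) with hc
  have hcc : Continuous c := by fun_prop
  have hcm : ∀ s, c s ∈ Set.Ico (0 : ℝ) τ := fun s =>
    ⟨le_max_left _ _, max_lt hτ ((min_le_right _ _).trans_lt ht₁.2)⟩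
  have hci : ∀ s ∈ Set.Icc (0 : ℝ) t₁, c s = s := by
    intro s hs
    simp [hc, hs.1, hs.2]
  have huc : Continuous (fun s => u (c s)) := hu.comp_continuous hcc hcm
  have hvc : Continuous (fun s => v (c s)) := hv.comp_continuous hcc hcm
  have hm : ∀ t : ℝ, 0 ≤ t → max t 0 = t := fun t ht => max_eq_left ht
  have hSj : Continuous (fun p : ℝ × C(K, ℝ) => T (max p.1 0) p.2) := by
    rw [continuous_iff_continuousAt]
    rintro ⟨t, w⟩
    have h1 : Continuous (fun p : ℝ × C(K, ℝ) => T (max p.1 0) w) :=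
      (hTcont w).comp_continuous (by fun_prop) (fun p => Set.mem_Ici.2 (le_max_right _ _))
    have h2 : Filter.Tendsto (fun p : ℝ × C(K, ℝ) => T (max p.1 0) (p.2 - w))
        (nhds (t, w)) (nhds 0) := by
      apply squeeze_zero_norm (fun p => hTcontr _ (le_max_right _ _) _)
      have : Continuous (fun p : ℝ × C(K, ℝ) => ‖p.2 - w‖) := by fun_prop
      simpa using this.tendsto (t, w)
    have h3 := h2.add (h1.tendsto (t, w))
    simpa [ContinuousAt] using h3
  have main := mild_aux (fun t => T (max t 0)) (by simpa using hT0)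
    (fun s t hs ht => by
      simp only [hm s hs, hm t ht, hm (t + s) (add_nonneg ht hs)]
      exact hTsemigroup s t hs ht)
    (fun t _ w => hTcontr _ (le_max_right _ _) w) hSj
    (fun s => H (u (c s) + v (c s))) (fun s => u (c s))
    (fun s => a * (1 + ‖v (c s)‖) ^ (2 * N + 1))
    (hHcont.comp (huc.add hvc)) huc (((hvc.norm.const_add 1).pow _).const_mul a) u₀ t₁ ht₁.1
    (fun t _ φ h1 h2 => hdiss _ _ φ h1 h2)
    (fun t ht => by
      simp only [hci t ht, hm t ht.1]
      rw [heq t ⟨ht.1, ht.2.trans_lt ht₁.2⟩]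
      congr 1
      apply intervalIntegral.integral_congr
      intro s hs
      rw [Set.uIcc_of_le ht.1] at hs
      simp only [hci s ⟨hs.1, hs.2.trans ht.2⟩, hm (t - s) (by linarith [hs.2])])
  simp only [hci t₁ ⟨ht₁.1, le_rfl⟩] at main
  convert main using 2
  apply intervalIntegral.integral_congr
  intro s hs
  rw [Set.uIcc_of_le ht₁.1] at hs
  simp only [hci s hs]
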